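/- arXiv:1304.0015 — 2 statements merged into one kernel-verified Lean document; each statement's English description precedes it below -/
import Mathlib

section
/- Fix a natural number k ≥ 1. For a function f : ℂ × ℂ → ℂ define (P f)(x, ħ) = ħ · x · ∂/∂x [ f(x, ħ) − ħ^k · x · (L^k f(·, ħ))(e^ħ · x) ] and, for ħ ≠ 0, (Q f)(x, ħ) = ∂f/∂ħ (x, ħ) − ½ · x · ∂/∂x ( x · ∂f/∂x (x, ħ) ) + (½ − k/ħ) · x · ∂f/∂x (x, ħ). Then for every function f : ℂ × ℂ → ℂ that is analytic on all of ℂ × ℂ, every x ∈ ℂ and every ħ ∈ ℂ with ħ ≠ 0: (P(Q f))(x, ħ) − (Q(P f))(x, ħ) = −(1/ħ) · (P f)(x, ħ). That is, the operators satisfy the commutation relation [P, Q] = −(1/ħ) P. -/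
/-- The operator `L` acting in the first variable: `(L g)(x) = d/dx (x · g(x))`. -/
noncomputable def Lop (g : ℂ → ℂ) : ℂ → ℂ := fun x => deriv (fun t => t * g t) x

/-- The quantum curve operator
`P = hbar x (∂/∂x) ∘ (1 − hbar^k x e^{hbar x ∂/∂x} ((∂/∂x)·x)^k)`:
`(P f)(x, hbar) = hbar x ∂/∂x [ f(x, hbar) − hbar^k x (L^k f(·, hbar))(e^hbar x) ]`. -/
noncomputable def Pop (k : ℕ) (f : ℂ → ℂ → ℂ) : ℂ → ℂ → ℂ := fun x hbar =>
  hbar * x *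
    deriv (fun y : ℂ =>
      f y hbar - hbar ^ k * y * (Lop^[k] (fun t => f t hbar)) (Complex.exp hbar * y)) x

/-- The Schrödinger operator `Q = ∂/∂hbar − ½ (x ∂/∂x)² + (½ − k/hbar) x ∂/∂x`:
`(Q f)(x, hbar) = ∂f/∂hbar − ½ x ∂/∂x (x ∂f/∂x) + (½ − k/hbar) x ∂f/∂x`. -/
noncomputable def Qop (k : ℕ) (f : ℂ → ℂ → ℂ) : ℂ → ℂ → ℂ := fun x hbar =>
  deriv (fun h : ℂ => f x h) hbar
    - (1 / 2) * x * deriv (fun y : ℂ => y * deriv (fun t : ℂ => f t hbar) y) x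
    + (1 / 2 - (k : ℂ) / hbar) * x * deriv (fun t : ℂ => f t hbar) x

open scoped ContDiff

/-- The functions of two complex variables that are analytic on all of `ℂ × ℂ`. -/
def entireFunctions : Submodule ℂ (ℂ → ℂ → ℂ) where
  carrier := {f | ContDiff ℂ ω (fun p : ℂ × ℂ => f p.1 p.2)}
  add_mem' {f g} (hf : ContDiff ℂ ω _) (hg : ContDiff ℂ ω _) := by
    change ContDiff ℂ ω _
    exact hf.add hg
  zero_mem' := by
    change ContDiff ℂ ω _
    exact contDiff_const
  smul_mem' c f (hf : ContDiff ℂ ω _) := by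
    change ContDiff ℂ ω _
    exact hf.const_smul c

namespace entireFunctions

lemma contDiff (f : entireFunctions) : ContDiff ℂ ω (fun p : ℂ × ℂ => f.1 p.1 p.2) := f.2

/-- The directional derivative in the direction `v`. -/
noncomputable def dirDeriv (v : ℂ × ℂ) : Module.End ℂ entireFunctions where
  toFun f := ⟨fun x h => fderiv ℂ (fun p : ℂ × ℂ => f.1 p.1 p.2) (x, h) v,
    ((contDiff f).fderiv_right (m := ω) le_top).clm_apply contDiff_const⟩
  map_add' f g := by
    ext x h
    have hf := (contDiff f).differentiable (by simp) (x, h)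
    have hg := (contDiff g).differentiable (by simp) (x, h)
    exact congrArg (fun T => T v) (fderiv_add hf hg)
  map_smul' c f := by
    ext x h
    have hf := (contDiff f).differentiable (by simp) (x, h)
    exact congrArg (fun T => T v) (fderiv_const_smul hf c)

lemma dirDeriv_commute (v w : ℂ × ℂ) : Commute (dirDeriv v) (dirDeriv w) := by
  ext f x h
  have hF : ContDiff ℂ ω (fun p : ℂ × ℂ => f.1 p.1 p.2) := contDiff f
  have hsymm : IsSymmSndFDerivAt ℂ (fun p : ℂ × ℂ => f.1 p.1 p.2) (x, h) :=
    hF.contDiffAt.isSymmSndFDerivAt le_top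
  have hd : DifferentiableAt ℂ (fderiv ℂ (fun p : ℂ × ℂ => f.1 p.1 p.2)) (x, h) :=
    (hF.fderiv_right (m := ω) le_top).differentiable (by simp) (x, h)
  have key (a b : ℂ × ℂ) : (dirDeriv a (dirDeriv b f)).1 x h =
      fderiv ℂ (fderiv ℂ (fun p : ℂ × ℂ => f.1 p.1 p.2)) (x, h) a b := by
    change fderiv ℂ (fun p => fderiv ℂ (fun p : ℂ × ℂ => f.1 p.1 p.2) p b) (x, h) a = _
    rw [fderiv_clm_apply hd (differentiableAt_const b)]
    simp
  exact (key v w).trans ((hsymm v w).trans (key w v).symm)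

lemma hasDerivAt_comp (f : entireFunctions) {u v : ℂ → ℂ} {u' v' t : ℂ}
    (hu : HasDerivAt u u' t) (hv : HasDerivAt v v' t) :
    HasDerivAt (fun s => f.1 (u s) (v s))
      (u' * (dirDeriv (1, 0) f).1 (u t) (v t) + v' * (dirDeriv (0, 1) f).1 (u t) (v t)) t := by
  have hF := ((contDiff f).differentiable (by simp) (u t, v t)).hasFDerivAt
  refine (hF.comp_hasDerivAt t (hu.prodMk hv)).congr_deriv ?_
  have : (u', v') = u' • ((1, 0) : ℂ × ℂ) + v' • ((0, 1) : ℂ × ℂ) := by simp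
  rw [this, map_add, map_smul, map_smul]
  rfl

lemma hasDerivAt_fst (f : entireFunctions) (x h : ℂ) :
    HasDerivAt (fun t => f.1 t h) ((dirDeriv (1, 0) f).1 x h) x := by
  simpa using hasDerivAt_comp f (hasDerivAt_id x) (hasDerivAt_const x h)

lemma hasDerivAt_snd (f : entireFunctions) (x h : ℂ) :
    HasDerivAt (fun t => f.1 x t) ((dirDeriv (0, 1) f).1 x h) h := by
  simpa using hasDerivAt_comp f (hasDerivAt_const h x) (hasDerivAt_id h)

/-- Multiplication by the first variable. -/
def mulFst : Module.End ℂ entireFunctions where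
  toFun f := ⟨fun x h => x * f.1 x h, contDiff_fst.mul (contDiff f)⟩
  map_add' f g := by ext x h; exact mul_add _ _ _
  map_smul' c f := by ext x h; exact mul_left_comm _ _ _

/-- Multiplication by the second variable. -/
def mulSnd : Module.End ℂ entireFunctions where
  toFun f := ⟨fun x h => h * f.1 x h, contDiff_snd.mul (contDiff f)⟩
  map_add' f g := by ext x h; exact mul_add _ _ _
  map_smul' c f := by ext x h; exact mul_left_comm _ _ _

/-- The dilation operator `e^{hbar x ∂/∂x}`. -/
noncomputable def dilation : Module.End ℂ entireFunctions where
  toFun f := ⟨fun x h => f.1 (Complex.exp h * x) h,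
    ContDiff.comp (g := fun p : ℂ × ℂ => f.1 p.1 p.2)
      (f := fun p : ℂ × ℂ => (Complex.exp p.2 * p.1, p.2)) (contDiff f)
      ((contDiff_snd.cexp.mul contDiff_fst).prodMk contDiff_snd)⟩
  map_add' _ _ := rfl
  map_smul' _ _ := rfl

/-- The Euler operator `x ∂/∂x`. -/
noncomputable def euler : Module.End ℂ entireFunctions := mulFst * dirDeriv (1, 0)

/-- The operator `hbar ∂/∂hbar`. -/
noncomputable def eulerSnd : Module.End ℂ entireFunctions := mulSnd * dirDeriv (0, 1)

lemma dirDeriv_fst_mulFst :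
    dirDeriv (1, 0) * mulFst = mulFst * dirDeriv (1, 0) + 1 := by
  ext f x h
  refine (hasDerivAt_fst (mulFst f) x h).unique
    (((hasDerivAt_id x).mul (hasDerivAt_fst f x h)).congr_deriv ?_)
  change 1 * f.1 x h + x * _ = x * _ + f.1 x h
  ring

lemma dirDeriv_snd_mulSnd :
    dirDeriv (0, 1) * mulSnd = mulSnd * dirDeriv (0, 1) + 1 := by
  ext f x h
  refine (hasDerivAt_snd (mulSnd f) x h).unique
    (((hasDerivAt_id h).mul (hasDerivAt_snd f x h)).congr_deriv ?_)
  change 1 * f.1 x h + h * _ = h * _ + f.1 x h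
  ring

lemma dirDeriv_fst_mulSnd : Commute (dirDeriv (1, 0)) mulSnd := by
  ext f x h
  exact (hasDerivAt_fst (mulSnd f) x h).unique ((hasDerivAt_fst f x h).const_mul h)

lemma dirDeriv_snd_mulFst : Commute (dirDeriv (0, 1)) mulFst := by
  ext f x h
  exact (hasDerivAt_snd (mulFst f) x h).unique ((hasDerivAt_snd f x h).const_mul x)

lemma mulFst_mulSnd : Commute mulFst mulSnd := by
  ext f x h
  exact mul_left_comm _ _ _

lemma dilation_mulSnd : Commute dilation mulSnd := rfl

lemma euler_dilation : Commute euler dilation := by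
  ext f x h
  have hd := (hasDerivAt_fst (dilation f) x h).unique
    (hasDerivAt_comp f ((hasDerivAt_id x).const_mul (Complex.exp h)) (hasDerivAt_const x h))
  change x * (dirDeriv (1, 0) (dilation f)).1 x h =
    Complex.exp h * x * (dirDeriv (1, 0) f).1 (Complex.exp h * x) h
  rw [hd]
  ring

lemma dirDeriv_snd_dilation :
    dirDeriv (0, 1) * dilation = dilation * (dirDeriv (0, 1) + euler) := by
  ext f x h
  refine (hasDerivAt_snd (dilation f) x h).unique ((hasDerivAt_comp f
    ((Complex.hasDerivAt_exp h).mul_const x) (hasDerivAt_id h)).congr_deriv ?_)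
  change _ = (dirDeriv (0, 1) f).1 (Complex.exp h * x) h +
    Complex.exp h * x * (dirDeriv (1, 0) f).1 (Complex.exp h * x) h
  simp only [id]
  ring

lemma euler_mulSnd : Commute euler mulSnd := mulFst_mulSnd.mul_left dirDeriv_fst_mulSnd

lemma eulerSnd_mulFst : Commute eulerSnd mulFst :=
  mulFst_mulSnd.symm.mul_left dirDeriv_snd_mulFst

lemma eulerSnd_euler : Commute eulerSnd euler :=
  eulerSnd_mulFst.mul_right (dirDeriv_fst_mulSnd.symm.mul_left (dirDeriv_commute _ _))

lemma euler_mulFst : euler * mulFst = mulFst * (euler + 1) := by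
  rw [euler, mul_assoc, dirDeriv_fst_mulFst]

lemma eulerSnd_dilation :
    eulerSnd * dilation = dilation * (eulerSnd + mulSnd * euler) := by
  rw [eulerSnd, mul_assoc, dirDeriv_snd_dilation, ← mul_assoc, ← dilation_mulSnd.eq, mul_assoc,
    mul_add]

lemma eulerSnd_mulSnd : eulerSnd * mulSnd = mulSnd * (eulerSnd + 1) := by
  rw [eulerSnd, mul_assoc, dirDeriv_snd_mulSnd]

lemma eulerSnd_mulSnd_pow (k : ℕ) :
    eulerSnd * mulSnd ^ k = mulSnd ^ k * (eulerSnd + (k : ℂ) • 1) := by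
  induction k with
  | zero => simp
  | succ k ih =>
    rw [pow_succ, ← mul_assoc, ih, mul_assoc, add_mul, eulerSnd_mulSnd,
      smul_mul_assoc, one_mul, ← mul_one ((k : ℂ) • mulSnd), smul_mul_assoc, ← mul_smul_comm,
      ← mul_add, ← mul_assoc]
    push_cast
    congr 1
    module

/-- The operator `hbar^k x e^{hbar x ∂/∂x} ((∂/∂x) x)^k`. -/
noncomputable def shift (k : ℕ) : Module.End ℂ entireFunctions :=
  mulSnd ^ k * (mulFst * (dilation * (euler + 1) ^ k))

/-- The quantum curve operator on entire functions. -/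
noncomputable def curveOp (k : ℕ) : Module.End ℂ entireFunctions :=
  mulSnd * euler * (1 + (-1 : ℂ) • shift k)

/-- The Schrödinger operator multiplied by `hbar`, on entire functions. -/
noncomputable def schrodingerOp (k : ℕ) : Module.End ℂ entireFunctions :=
  eulerSnd + (-1 / 2 : ℂ) • (mulSnd * (euler * euler)) + (1 / 2 : ℂ) • (mulSnd * euler)
    + (-k : ℂ) • euler

lemma shift_mulSnd (k : ℕ) : Commute (shift k) mulSnd :=
  ((Commute.refl mulSnd).pow_left k).mul_left (mulFst_mulSnd.mul_left
    (dilation_mulSnd.mul_left ((euler_mulSnd.add_left (Commute.one_left _)).pow_left k)))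

lemma euler_shift (k : ℕ) : euler * shift k = shift k * (euler + 1) := by
  have hL : Commute (euler + 1) (dilation * (euler + 1) ^ k) :=
    (euler_dilation.add_left (Commute.one_left _)).mul_right ((Commute.refl _).pow_right k)
  rw [shift, ← mul_assoc, (euler_mulSnd.pow_right k).eq, mul_assoc, ← mul_assoc euler,
    euler_mulFst, mul_assoc, hL.eq]
  simp only [mul_assoc]

lemma eulerSnd_shift (k : ℕ) :
    eulerSnd * shift k = shift k *
      (eulerSnd + mulSnd * euler + (k : ℂ) • 1) := by
  have hL : Commute (eulerSnd + mulSnd * euler) ((euler + 1) ^ k) := by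
    refine Commute.pow_right (Commute.add_right (Commute.add_left eulerSnd_euler ?_)
      (Commute.one_right _)) k
    exact euler_mulSnd.symm.mul_left (Commute.refl _)
  have hB : eulerSnd * (mulFst * (dilation * (euler + 1) ^ k)) =
      mulFst * (dilation * (euler + 1) ^ k) * (eulerSnd + mulSnd * euler) := by
    rw [← mul_assoc, eulerSnd_mulFst.eq, mul_assoc, ← mul_assoc eulerSnd, eulerSnd_dilation,
      mul_assoc, hL.eq]
    simp only [mul_assoc]
  rw [shift, ← mul_assoc, eulerSnd_mulSnd_pow, mul_assoc, add_mul, hB]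
  simp only [mul_assoc, mul_add, smul_mul_assoc, mul_smul_comm, one_mul, mul_one]

lemma schrodingerOp_shift (k : ℕ) : Commute (schrodingerOp k) (shift k) := by
  have h1 : mulSnd * euler * shift k = shift k * (mulSnd * (euler + 1)) := by
    rw [mul_assoc, euler_shift, ← mul_assoc, ← (shift_mulSnd k).eq, mul_assoc]
  have h2 : mulSnd * (euler * euler) * shift k =
      shift k * (mulSnd * ((euler + 1) * (euler + 1))) := by
    rw [← mul_assoc, mul_assoc _ euler, euler_shift, ← mul_assoc, h1]
    simp only [mul_assoc]
  rw [Commute, SemiconjBy, schrodingerOp, add_mul, add_mul, add_mul, smul_mul_assoc,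
    smul_mul_assoc, smul_mul_assoc, h1, h2, euler_shift, eulerSnd_shift]
  simp only [mul_add, add_mul, mul_smul_comm, mul_one, one_mul]
  module

lemma schrodingerOp_curveOp (k : ℕ) :
    schrodingerOp k * curveOp k = curveOp k * schrodingerOp k + curveOp k := by
  have hHE : Commute (mulSnd * euler) mulSnd := (Commute.refl _).mul_left euler_mulSnd
  have hEE : Commute (mulSnd * euler) euler := euler_mulSnd.symm.mul_left (Commute.refl _)
  have h1 : eulerSnd * (mulSnd * euler) = mulSnd * euler * eulerSnd + mulSnd * euler := by
    rw [← mul_assoc, eulerSnd_mulSnd, mul_assoc, add_mul, eulerSnd_euler.eq, mul_add, one_mul,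
      mul_assoc]
  have h2 : schrodingerOp k * (mulSnd * euler) =
      mulSnd * euler * schrodingerOp k + mulSnd * euler := by
    rw [schrodingerOp, add_mul, add_mul, add_mul, h1, smul_mul_assoc, smul_mul_assoc,
      smul_mul_assoc, ← (hHE.mul_right (hEE.mul_right hEE)).eq, ← hEE.eq,
      mul_add, mul_add, mul_add, mul_smul_comm, mul_smul_comm, mul_smul_comm]
    abel
  have h3 : Commute (schrodingerOp k) (1 + (-1 : ℂ) • shift k) :=
    (Commute.one_right _).add_right ((schrodingerOp_shift k).smul_right _)
  rw [curveOp, ← mul_assoc, h2, add_mul, mul_assoc, h3.eq, ← mul_assoc]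

lemma Lop_apply (f : entireFunctions) (h : ℂ) :
    Lop (fun t => f.1 t h) = fun t => ((euler + 1) f).1 t h := by
  ext x
  refine (((hasDerivAt_id x).mul (hasDerivAt_fst f x h)).congr_deriv ?_).deriv
  change 1 * f.1 x h + x * _ = x * _ + f.1 x h
  ring

lemma Lop_iterate_apply (f : entireFunctions) (h : ℂ) (n : ℕ) :
    Lop^[n] (fun t => f.1 t h) = fun t => (((euler + 1) ^ n) f).1 t h := by
  induction n with
  | zero => rfl
  | succ n ih => rw [Function.iterate_succ_apply', ih, Lop_apply, pow_succ']; rfl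

lemma mulSnd_pow_apply (f : entireFunctions) (n : ℕ) (x h : ℂ) :
    ((mulSnd ^ n) f).1 x h = h ^ n * f.1 x h := by
  induction n with
  | zero => simp
  | succ n ih =>
    rw [pow_succ', pow_succ', mul_assoc, ← ih]
    rfl

lemma Pop_apply (k : ℕ) (f : entireFunctions) : Pop k f.1 = (curveOp k f).1 := by
  ext x h
  have hshift (y : ℂ) : f.1 y h - h ^ k * y *
      (Lop^[k] (fun t => f.1 t h)) (Complex.exp h * y) = ((1 + (-1 : ℂ) • shift k) f).1 y h := by
    rw [Lop_iterate_apply, mul_assoc]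
    have hs := mulSnd_pow_apply ((mulFst * (dilation * (euler + 1) ^ k)) f) k y h
    change _ = f.1 y h + -1 * ((mulSnd ^ k) ((mulFst * (dilation * (euler + 1) ^ k)) f)).1 y h
    rw [hs, neg_one_mul, ← sub_eq_add_neg]
    rfl
  rw [Pop]
  simp only [hshift]
  rw [(hasDerivAt_fst ((1 + (-1 : ℂ) • shift k) f) x h).deriv, mul_assoc]
  rfl

lemma Qop_apply (k : ℕ) (f : entireFunctions) (x : ℂ) {h : ℂ} (hh : h ≠ 0) :
    Qop k f.1 x h = (h⁻¹ • schrodingerOp k f).1 x h := by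
  have h1 (y : ℂ) : y * deriv (fun t => f.1 t h) y = (euler f).1 y h := by
    rw [(hasDerivAt_fst f y h).deriv]
    rfl
  have h2 : x * deriv (fun y => (euler f).1 y h) x = (euler (euler f)).1 x h := by
    rw [(hasDerivAt_fst (euler f) x h).deriv]
    rfl
  rw [Qop]
  simp only [mul_assoc, h1, h2]
  rw [(hasDerivAt_snd f x h).deriv]
  change _ = h⁻¹ * (h * (dirDeriv (0, 1) f).1 x h + (-1 / 2) * (h * (euler (euler f)).1 x h)
    + (1 / 2) * (h * (euler f).1 x h) + (-k) * (euler f).1 x h)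
  field_simp
  ring

end entireFunctions

lemma Pop_congr (k : ℕ) {f g : ℂ → ℂ → ℂ} {h : ℂ} (hfg : ∀ y, f y h = g y h) (x : ℂ) :
    Pop k f x h = Pop k g x h := by
  simp only [Pop, hfg]

open entireFunctions in
/-- The commutation relation `[P, Q] = −(1/hbar) P`: for every `f` analytic on all of
`ℂ × ℂ`, every `x` and every `hbar ≠ 0`,
`(P(Q f))(x, hbar) − (Q(P f))(x, hbar) = −(1/hbar) (P f)(x, hbar)`. -/
theorem commutation_relation_PQ (k : ℕ) (hk : 1 ≤ k) (f : ℂ → ℂ → ℂ)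
    (hf : AnalyticOnNhd ℂ (fun p : ℂ × ℂ => f p.1 p.2) Set.univ)
    (x hbar : ℂ) (hh : hbar ≠ 0) :
    Pop k (Qop k f) x hbar - Qop k (Pop k f) x hbar = -(1 / hbar) * Pop k f x hbar := by
  obtain ⟨F, rfl⟩ : ∃ F : entireFunctions, F.1 = f :=
    ⟨⟨f, contDiff_omega_iff_analyticOnNhd.2 hf⟩, rfl⟩
  rw [Pop_congr k (fun y => Qop_apply k F y hh) x, Pop_apply, Pop_apply, Qop_apply k _ x hh,
    map_smul]
  have key : (schrodingerOp k (curveOp k F)).1 x hbar =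
      (curveOp k (schrodingerOp k F)).1 x hbar + (curveOp k F).1 x hbar :=
    congrArg (fun T : Module.End ℂ entireFunctions => (T F).1 x hbar) (schrodingerOp_curveOp k)
  change hbar⁻¹ * _ - hbar⁻¹ * _ = _
  rw [key]
  ring
end

section
/- Fix a natural number k ≥ 1. For a function f : ℂ × ℂ → ℂ define (A f)(x, ħ) = ħ^k · x · (L^k f(·, ħ))(e^ħ · x) and, for ħ ≠ 0, (Q f)(x, ħ) = ∂f/∂ħ (x, ħ) − ½ · x · ∂/∂x ( x · ∂f/∂x (x, ħ) ) + (½ − k/ħ) · x · ∂f/∂x (x, ħ). Then for every function f : ℂ × ℂ → ℂ that is analytic on all of ℂ × ℂ, every x ∈ ℂ and every ħ ∈ ℂ with ħ ≠ 0: (A(Q f))(x, ħ) = (Q(A f))(x, ħ), i.e. the operator A = ħ^k x e^{ħ x ∂/∂x} ((∂/∂x)·x)^k commutes with Q. -/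
/-- The operator `A = hbar^k x e^{hbar x ∂/∂x} ((∂/∂x)·x)^k`:
`(A f)(x, hbar) = hbar^k · x · (L^k f(·, hbar))(e^hbar · x)`. -/
noncomputable def Aop (k : ℕ) (f : ℂ → ℂ → ℂ) : ℂ → ℂ → ℂ := fun x hbar =>
  hbar ^ k * x * (Lop^[k] (fun t => f t hbar)) (Complex.exp hbar * x)

open scoped ContDiff

/-- The Euler operator `x d/dx`. -/
noncomputable def eulerOp (g : ℂ → ℂ) : ℂ → ℂ := fun x => x * deriv g x

/-- The partial derivative in the second variable. -/
noncomputable def partialSnd (f : ℂ → ℂ → ℂ) : ℂ → ℂ → ℂ := fun x h => deriv (fun s => f x s) h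

/-- The operator `Lop` applied in the first variable of a function of two variables. -/
noncomputable def LopFst (f : ℂ → ℂ → ℂ) : ℂ → ℂ → ℂ := fun x h => Lop (fun t => f t h) x

theorem Lop_apply {g : ℂ → ℂ} (hg : Differentiable ℂ g) (x : ℂ) :
    Lop g x = g x + x * deriv g x := by
  have h := (hasDerivAt_id' x).fun_mul (hg x).hasDerivAt
  simpa [Lop] using h.deriv

theorem Differentiable.deriv_entire {g : ℂ → ℂ} (hg : Differentiable ℂ g) :
    Differentiable ℂ (_root_.deriv g) :=
  (hg.contDiff (n := 2)).differentiable_deriv_two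

theorem Differentiable.eulerOp {g : ℂ → ℂ} (hg : Differentiable ℂ g) :
    Differentiable ℂ (eulerOp g) :=
  differentiable_id.mul hg.deriv_entire

theorem Differentiable.Lop {g : ℂ → ℂ} (hg : Differentiable ℂ g) : Differentiable ℂ (Lop g) :=
  (differentiable_id.mul hg).deriv_entire

theorem Differentiable.iterate_Lop {g : ℂ → ℂ} (hg : Differentiable ℂ g) (n : ℕ) :
    Differentiable ℂ (_root_.Lop^[n] g) := by
  induction n with
  | zero => exact hg
  | succ n ih => rw [Function.iterate_succ_apply']; exact ih.Lop

theorem Lop_eulerOp {g : ℂ → ℂ} (hg : Differentiable ℂ g) :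
    Lop (eulerOp g) = eulerOp (Lop g) := by
  have hL : Lop g = fun x => g x + eulerOp g x := funext fun x => Lop_apply hg x
  funext x
  rw [Lop_apply hg.eulerOp, hL]
  have h : deriv (fun x => g x + eulerOp g x) x = deriv g x + deriv (eulerOp g) x :=
    deriv_fun_add (hg x) (hg.eulerOp x)
  simp only [eulerOp] at h ⊢
  rw [h]
  ring

theorem iterate_Lop_eulerOp {g : ℂ → ℂ} (hg : Differentiable ℂ g) (n : ℕ) :
    Lop^[n] (eulerOp g) = eulerOp (Lop^[n] g) := by
  induction n with
  | zero => rfl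
  | succ n ih =>
    rw [Function.iterate_succ_apply', Function.iterate_succ_apply', ih,
      Lop_eulerOp (hg.iterate_Lop n)]

theorem Lop_add {u v : ℂ → ℂ} (hu : Differentiable ℂ u) (hv : Differentiable ℂ v) :
    Lop (u + v) = Lop u + Lop v := by
  funext x
  rw [Pi.add_apply, Lop_apply (hu.add hv), Lop_apply hu, Lop_apply hv, deriv_add (hu x) (hv x),
    Pi.add_apply]
  ring

theorem Lop_const_smul (c : ℂ) {u : ℂ → ℂ} (hu : Differentiable ℂ u) :
    Lop (c • u) = c • Lop u := by
  funext x
  rw [Pi.smul_apply, Lop_apply (hu.const_smul c), Lop_apply hu, deriv_const_smul c (hu x),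
    Pi.smul_apply]
  simp only [smul_eq_mul]
  ring

theorem iterate_Lop_add {u v : ℂ → ℂ} (hu : Differentiable ℂ u) (hv : Differentiable ℂ v)
    (n : ℕ) : Lop^[n] (u + v) = Lop^[n] u + Lop^[n] v := by
  induction n with
  | zero => rfl
  | succ n ih =>
    simp only [Function.iterate_succ_apply', ih, Lop_add (hu.iterate_Lop n) (hv.iterate_Lop n)]

theorem iterate_Lop_const_smul (c : ℂ) {u : ℂ → ℂ} (hu : Differentiable ℂ u) (n : ℕ) :
    Lop^[n] (c • u) = c • Lop^[n] u := by
  induction n with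
  | zero => rfl
  | succ n ih =>
    simp only [Function.iterate_succ_apply', ih, Lop_const_smul c (hu.iterate_Lop n)]

theorem LopFst_iterate (f : ℂ → ℂ → ℂ) (n : ℕ) (h : ℂ) :
    (fun t => LopFst^[n] f t h) = Lop^[n] (fun t => f t h) := by
  induction n with
  | zero => rfl
  | succ n ih => rw [Function.iterate_succ_apply', Function.iterate_succ_apply', ← ih]; rfl

section TwoVariables

variable {f : ℂ → ℂ → ℂ}

theorem hasDerivAt_fst (hf : ContDiff ℂ ω (fun p : ℂ × ℂ => f p.1 p.2)) (x h : ℂ) :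
    HasDerivAt (fun t => f t h) (fderiv ℂ (fun p : ℂ × ℂ => f p.1 p.2) (x, h) (1, 0)) x :=
  HasFDerivAt.comp_hasDerivAt (f := fun t => (t, h)) x
    ((hf.differentiable (by simp)) (x, h)).hasFDerivAt ((hasDerivAt_id x).prodMk (hasDerivAt_const x h))

theorem hasDerivAt_snd (hf : ContDiff ℂ ω (fun p : ℂ × ℂ => f p.1 p.2)) (x h : ℂ) :
    HasDerivAt (fun s => f x s) (fderiv ℂ (fun p : ℂ × ℂ => f p.1 p.2) (x, h) (0, 1)) h :=
  HasFDerivAt.comp_hasDerivAt (f := fun s => (x, s)) h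
    ((hf.differentiable (by simp)) (x, h)).hasFDerivAt ((hasDerivAt_const h x).prodMk (hasDerivAt_id h))

theorem contDiff_fderiv_apply (hf : ContDiff ℂ ω (fun p : ℂ × ℂ => f p.1 p.2)) (v : ℂ × ℂ) :
    ContDiff ℂ ω (fun p : ℂ × ℂ => fderiv ℂ (fun p : ℂ × ℂ => f p.1 p.2) p v) :=
  (hf.fderiv_right (m := ω) (by simp)).clm_apply contDiff_const

theorem differentiable_slice_fst (hf : ContDiff ℂ ω (fun p : ℂ × ℂ => f p.1 p.2)) (h : ℂ) :
    Differentiable ℂ (fun t => f t h) :=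
  fun x => (hasDerivAt_fst hf x h).differentiableAt

theorem partialSnd_eq (hf : ContDiff ℂ ω (fun p : ℂ × ℂ => f p.1 p.2)) :
    partialSnd f = fun x h => fderiv ℂ (fun p : ℂ × ℂ => f p.1 p.2) (x, h) (0, 1) := by
  funext x h
  exact (hasDerivAt_snd hf x h).deriv

theorem LopFst_eq (hf : ContDiff ℂ ω (fun p : ℂ × ℂ => f p.1 p.2)) :
    LopFst f =
      fun x h => f x h + x * fderiv ℂ (fun p : ℂ × ℂ => f p.1 p.2) (x, h) (1, 0) := by
  funext x h
  rw [LopFst, Lop_apply (differentiable_slice_fst hf h), (hasDerivAt_fst hf x h).deriv]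

theorem contDiff_partialSnd (hf : ContDiff ℂ ω (fun p : ℂ × ℂ => f p.1 p.2)) :
    ContDiff ℂ ω (fun p : ℂ × ℂ => partialSnd f p.1 p.2) := by
  rw [partialSnd_eq hf]
  exact contDiff_fderiv_apply hf (0, 1)

theorem contDiff_LopFst (hf : ContDiff ℂ ω (fun p : ℂ × ℂ => f p.1 p.2)) :
    ContDiff ℂ ω (fun p : ℂ × ℂ => LopFst f p.1 p.2) := by
  rw [LopFst_eq hf]
  exact hf.add (contDiff_fst.mul (contDiff_fderiv_apply hf (1, 0)))

theorem contDiff_iterate_LopFst (hf : ContDiff ℂ ω (fun p : ℂ × ℂ => f p.1 p.2)) (n : ℕ) :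
    ContDiff ℂ ω (fun p : ℂ × ℂ => LopFst^[n] f p.1 p.2) := by
  induction n with
  | zero => exact hf
  | succ n ih => rw [Function.iterate_succ_apply']; exact contDiff_LopFst ih

theorem fderiv_fderiv_apply (hf : ContDiff ℂ ω (fun p : ℂ × ℂ => f p.1 p.2)) (p v w : ℂ × ℂ) :
    fderiv ℂ (fun q => fderiv ℂ (fun p : ℂ × ℂ => f p.1 p.2) q v) p w =
      fderiv ℂ (fderiv ℂ (fun p : ℂ × ℂ => f p.1 p.2)) p w v := by
  have hd : DifferentiableAt ℂ (fderiv ℂ (fun p : ℂ × ℂ => f p.1 p.2)) p :=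
    ((hf.fderiv_right (m := ω) (by simp)).differentiable (by simp)) p
  rw [fderiv_clm_apply hd (differentiableAt_const v)]
  simp

theorem partialSnd_LopFst (hf : ContDiff ℂ ω (fun p : ℂ × ℂ => f p.1 p.2)) :
    partialSnd (LopFst f) = LopFst (partialSnd f) := by
  have hsymm (p : ℂ × ℂ) : IsSymmSndFDerivAt ℂ (fun p : ℂ × ℂ => f p.1 p.2) p :=
    hf.contDiffAt.isSymmSndFDerivAt (by simp)
  rw [LopFst_eq (contDiff_partialSnd hf), partialSnd_eq hf, LopFst_eq hf]
  funext x h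
  have hx := hasDerivAt_snd
    (f := fun x h => fderiv ℂ (fun p : ℂ × ℂ => f p.1 p.2) (x, h) (1, 0))
    (contDiff_fderiv_apply hf (1, 0)) x h
  refine ((hasDerivAt_snd hf x h).add (hx.const_mul x)).deriv.trans ?_
  congr 2
  exact (fderiv_fderiv_apply hf _ _ _).trans
    ((hsymm (x, h) _ _).trans (fderiv_fderiv_apply hf _ _ _).symm)

theorem partialSnd_iterate_LopFst (hf : ContDiff ℂ ω (fun p : ℂ × ℂ => f p.1 p.2)) (n : ℕ) :
    partialSnd (LopFst^[n] f) = LopFst^[n] (partialSnd f) := by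
  induction n with
  | zero => rfl
  | succ n ih =>
    rw [Function.iterate_succ_apply', Function.iterate_succ_apply', ← ih,
      partialSnd_LopFst (contDiff_iterate_LopFst hf n)]

theorem hasDerivAt_comp_exp_mul (hf : ContDiff ℂ ω (fun p : ℂ × ℂ => f p.1 p.2)) (x h : ℂ) :
    HasDerivAt (fun s => f (Complex.exp s * x) s)
      (eulerOp (fun t => f t h) (Complex.exp h * x) + partialSnd f (Complex.exp h * x) h) h := by
  have hc : HasDerivAt (fun s => (Complex.exp s * x, s)) (Complex.exp h * x, 1) h :=
    ((Complex.hasDerivAt_exp h).mul_const x).prodMk (hasDerivAt_id h)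
  have hd := HasFDerivAt.comp_hasDerivAt (f := fun s => (Complex.exp s * x, s)) h
    ((hf.differentiable (by simp)) (Complex.exp h * x, h)).hasFDerivAt hc
  refine hd.congr_deriv ?_
  have hv : (Complex.exp h * x, (1 : ℂ)) =
      (Complex.exp h * x) • ((1, 0) : ℂ × ℂ) + ((0, 1) : ℂ × ℂ) := by simp
  rw [partialSnd_eq hf, eulerOp, (hasDerivAt_fst hf _ h).deriv, hv, map_add, map_smul]
  simp

end TwoVariables

theorem Qop_apply (k : ℕ) (f : ℂ → ℂ → ℂ) (x h : ℂ) :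
    Qop k f x h = partialSnd f x h + (-(1 / 2 : ℂ)) * eulerOp (eulerOp fun t => f t h) x
      + (1 / 2 - (k : ℂ) / h) * eulerOp (fun t => f t h) x := by
  unfold Qop partialSnd eulerOp
  ring

theorem eulerOp_mul_comp_mul (a c : ℂ) {g : ℂ → ℂ} (hg : Differentiable ℂ g) :
    eulerOp (fun t => a * t * g (c * t)) = fun t => a * t * (g (c * t) + eulerOp g (c * t)) := by
  funext t
  have h1 : HasDerivAt (fun t => g (c * t)) (deriv g (c * t) * (c * 1)) t :=
    (hg (c * t)).hasDerivAt.comp t ((hasDerivAt_id t).const_mul c)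
  have h2 := ((hasDerivAt_id t).const_mul a).mul h1
  have h3 : deriv (fun t => a * t * g (c * t)) t = _ := h2.deriv
  simp only [eulerOp, h3, id]
  ring

/-- The operator `A` commutes with `Q`: for every `f` analytic on all of `ℂ × ℂ`,
every `x` and every `hbar ≠ 0`, `(A(Q f))(x, hbar) = (Q(A f))(x, hbar)`. -/
theorem A_commutes_with_Q (k : ℕ) (hk : 1 ≤ k) (f : ℂ → ℂ → ℂ)
    (hf : AnalyticOnNhd ℂ (fun p : ℂ × ℂ => f p.1 p.2) Set.univ)
    (x hbar : ℂ) (hh : hbar ≠ 0) :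
    Aop k (Qop k f) x hbar = Qop k (Aop k f) x hbar := by
  have hF : ContDiff ℂ ω (fun p : ℂ × ℂ => f p.1 p.2) := contDiffOn_univ.1 (hf.contDiffOn uniqueDiffOn_univ)
  have hg := differentiable_slice_fst hF hbar
  have hG := hg.iterate_Lop k
  have hLQ : Lop^[k] (fun t => Qop k f t hbar) =
      (fun t => partialSnd (LopFst^[k] f) t hbar)
        + (-(1 / 2 : ℂ)) • eulerOp (eulerOp (Lop^[k] fun t => f t hbar))
        + (1 / 2 - (k : ℂ) / hbar) • eulerOp (Lop^[k] fun t => f t hbar) := by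
    have hQ : (fun t => Qop k f t hbar) = (fun t => partialSnd f t hbar)
        + (-(1 / 2 : ℂ)) • eulerOp (eulerOp fun t => f t hbar)
        + (1 / 2 - (k : ℂ) / hbar) • eulerOp (fun t => f t hbar) :=
      funext fun t => Qop_apply k f t hbar
    have hp := differentiable_slice_fst (contDiff_partialSnd hF) hbar
    rw [hQ, iterate_Lop_add (hp.add (hg.eulerOp.eulerOp.const_smul _)) (hg.eulerOp.const_smul _),
      iterate_Lop_add hp (hg.eulerOp.eulerOp.const_smul _),
      iterate_Lop_const_smul _ hg.eulerOp.eulerOp, iterate_Lop_const_smul _ hg.eulerOp,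
      iterate_Lop_eulerOp hg.eulerOp, iterate_Lop_eulerOp hg, partialSnd_iterate_LopFst hF,
      LopFst_iterate]
  have hA : Aop k f = fun y s => s ^ k * y * LopFst^[k] f (Complex.exp s * y) s := by
    funext y s
    rw [Aop, ← LopFst_iterate]
  have hE : eulerOp (fun t => Aop k f t hbar) = fun t => hbar ^ k * t *
      ((Lop^[k] fun t => f t hbar) + eulerOp (Lop^[k] fun t => f t hbar))
        (Complex.exp hbar * t) :=
    eulerOp_mul_comp_mul _ _ hG
  have hE_add : eulerOp ((Lop^[k] fun t => f t hbar) + eulerOp (Lop^[k] fun t => f t hbar)) =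
      eulerOp (Lop^[k] fun t => f t hbar) + eulerOp (eulerOp (Lop^[k] fun t => f t hbar)) := by
    funext t
    rw [eulerOp, deriv_add (hG t) (hG.eulerOp t), mul_add]
    rfl
  have hS : partialSnd (Aop k f) x hbar =
      k * hbar ^ (k - 1) * x * LopFst^[k] f (Complex.exp hbar * x) hbar
        + hbar ^ k * x * (eulerOp (fun t => LopFst^[k] f t hbar) (Complex.exp hbar * x)
          + partialSnd (LopFst^[k] f) (Complex.exp hbar * x) hbar) := by
    rw [hA]
    exact (((hasDerivAt_pow k hbar).mul_const x).mul
      (hasDerivAt_comp_exp_mul (contDiff_iterate_LopFst hF k) x hbar)).deriv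
  have hval : LopFst^[k] f (Complex.exp hbar * x) hbar =
      (Lop^[k] fun t => f t hbar) (Complex.exp hbar * x) :=
    congrFun (LopFst_iterate f k hbar) _
  have hpow : (k : ℂ) * hbar ^ (k - 1) = k / hbar * hbar ^ k := by
    rw [div_mul_eq_mul_div, eq_div_iff hh, mul_assoc, pow_sub_one_mul (by omega)]
  rw [Qop_apply, hS, hE, eulerOp_mul_comp_mul _ _ (hG.add hG.eulerOp), hE_add, LopFst_iterate,
    hval, hpow, Aop, hLQ]
  simp only [Pi.add_apply, Pi.smul_apply, smul_eq_mul]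
  ring
end
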